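/- Let M be an irreducible affine algebraic monoid with unit group G and let H ⊆ G be a subgroup, closed in M. Then H is observable in M if and only if for every finite-dimensional rational right H-module V there exist a finite-dimensional rational right M-module W and an injective morphism of right H-modules ξ: V → W|_H. -/

import Mathlib

open MvPolynomial

namespace AlgebraicMonoid

variable (k : Type) [Field k] [IsAlgClosed k] (n : ℕ)

/-- `n × n` matrices over `k`: the ambient affine space for linear algebraic monoids. -/
abbrev Mat := Matrix (Fin n) (Fin n) k

/-- Polynomial functions on the space of `n × n` matrices. -/
abbrev MPoly := MvPolynomial (Fin n × Fin n) k

variable {k n}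

/-- Evaluation of a polynomial at a matrix. -/
noncomputable def mEval (x : Mat k n) (p : MPoly k n) : k :=
  eval (fun ij => x ij.1 ij.2) p

/-- The (regular function induced by) `p` vanishes identically on `X`. -/
def VanishesOn (X : Set (Mat k n)) (p : MPoly k n) : Prop :=
  ∀ x ∈ X, mEval x p = 0

/-- Zariski closed subsets of matrix space. -/
def ZClosed (X : Set (Mat k n)) : Prop :=
  ∃ S : Set (MPoly k n), X = {x | ∀ p ∈ S, mEval x p = 0}

/-- An affine (linear) algebraic monoid, realized as a Zariski closed submonoid of
matrix space (every affine algebraic monoid admits such a closed embedding). -/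
structure IsAlgMonoid (M : Set (Mat k n)) : Prop where
  zclosed : ZClosed M
  one_mem : (1 : Mat k n) ∈ M
  mul_mem : ∀ a ∈ M, ∀ b ∈ M, a * b ∈ M

/-- The unit group `G(M)` of the monoid `M`. -/
def unitGroup (M : Set (Mat k n)) : Set (Mat k n) :=
  {g | g ∈ M ∧ ∃ h ∈ M, g * h = 1 ∧ h * g = 1}

/-- `H` is an (abstract) subgroup of `G`. -/
def IsSubgroupOf (H G : Set (Mat k n)) : Prop :=
  H ⊆ G ∧ (1 : Mat k n) ∈ H ∧ (∀ a ∈ H, ∀ b ∈ H, a * b ∈ H) ∧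
    ∀ a ∈ H, ∃ b ∈ H, a * b = 1 ∧ b * a = 1

/-- `Y` is closed in `X` (for the Zariski topology). -/
def IsClosedIn (Y X : Set (Mat k n)) : Prop :=
  Y ⊆ X ∧ ∃ C : Set (Mat k n), ZClosed C ∧ Y = C ∩ X

/-- `X` is irreducible: nonempty, and its vanishing ideal is prime. -/
def IrreducibleSet (X : Set (Mat k n)) : Prop :=
  X.Nonempty ∧ ∀ p q : MPoly k n, VanishesOn X (p * q) → VanishesOn X p ∨ VanishesOn X q

/-- The action of `H` on `M` by left multiplication is observable: every nonzero
`H`-stable ideal of `k[M]` (presented as an ideal of the polynomial ring containing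
the vanishing ideal of `M`) contains a nonzero `H`-invariant function.
Here `H` acts on `k[M]` by `(f · h)(m) = f (h * m)`. -/
def LeftObservable (H M : Set (Mat k n)) : Prop :=
  ∀ J : Ideal (MPoly k n),
    (∀ p : MPoly k n, VanishesOn M p → p ∈ J) →
    (∀ p ∈ J, ∀ h ∈ H, ∃ p' ∈ J, ∀ m ∈ M, mEval m p' = mEval (h * m) p) →
    (∃ p ∈ J, ¬ VanishesOn M p) →
    ∃ p ∈ J, (¬ VanishesOn M p) ∧ ∀ h ∈ H, ∀ m ∈ M, mEval (h * m) p = mEval m p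

/-- `χ` defines a character of (the monoid) `X`, i.e. a regular multiplicative map to `k`. -/
structure IsCharacterOn (X : Set (Mat k n)) (χ : MPoly k n) : Prop where
  map_one : mEval 1 χ = 1
  map_mul : ∀ a ∈ X, ∀ b ∈ X, mEval (a * b) χ = mEval a χ * mEval b χ

/-- The character `χ` of `H` is extendible to `M`: there is a nonzero
`H`-semiinvariant `f ∈ k[M]` of weight `χ`, i.e. `f(h m) = χ(h) f(m)`. -/
def Extendible (M H : Set (Mat k n)) (χ : MPoly k n) : Prop :=
  ∃ f : MPoly k n, (¬ VanishesOn M f) ∧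
    ∀ h ∈ H, ∀ m ∈ M, mEval (h * m) f = mEval h χ * mEval m f

/-- The matrix of regular functions `P` evaluated at `x`: a rational representation. -/
noncomputable def repApply {d : ℕ} (P : Matrix (Fin d) (Fin d) (MPoly k n)) (x : Mat k n) :
    Matrix (Fin d) (Fin d) k :=
  Matrix.of fun i j => mEval x (P i j)

/-- `P` defines a (finite dimensional rational) right `M`-module structure on `k^d`,
the action being `v · x = v ᵥ* (P x)`. -/
def IsRightRep {d : ℕ} (M : Set (Mat k n)) (P : Matrix (Fin d) (Fin d) (MPoly k n)) : Prop :=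
  repApply P 1 = 1 ∧ ∀ a ∈ M, ∀ b ∈ M, repApply P (a * b) = repApply P a * repApply P b

end AlgebraicMonoid

namespace AlgebraicMonoid

section

variable {k : Type} [Field k] {n : ℕ}

lemma mEval_one (x : Mat k n) : mEval x (1 : MPoly k n) = 1 := map_one _

lemma mEval_add (x : Mat k n) (p q : MPoly k n) : mEval x (p + q) = mEval x p + mEval x q :=
  map_add _ _ _

lemma mEval_sub (x : Mat k n) (p q : MPoly k n) : mEval x (p - q) = mEval x p - mEval x q :=
  map_sub _ _ _

lemma mEval_mul (x : Mat k n) (p q : MPoly k n) : mEval x (p * q) = mEval x p * mEval x q :=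
  map_mul _ _ _

lemma mEval_C (x : Mat k n) (c : k) : mEval x (C c : MPoly k n) = c := eval_C _

lemma mEval_smul (x : Mat k n) (c : k) (p : MPoly k n) : mEval x (c • p) = c * mEval x p :=
  smul_eval _ _ _

lemma mEval_sum {ι : Type*} (x : Mat k n) (s : Finset ι) (p : ι → MPoly k n) :
    mEval x (∑ i ∈ s, p i) = ∑ i ∈ s, mEval x (p i) :=
  map_sum _ _ _

lemma mEval_det {ι : Type*} [Fintype ι] [DecidableEq ι] (x : Mat k n)
    (P : Matrix ι ι (MPoly k n)) :
    mEval x P.det = (Matrix.of fun i j => mEval x (P i j)).det :=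
  RingHom.map_det _ _

/-- The generic determinant, as a polynomial function on matrices. -/
noncomputable def detPoly (k : Type) [Field k] (n : ℕ) : MPoly k n :=
  (Matrix.of fun i j => (X (i, j) : MPoly k n)).det

lemma mEval_detPoly (x : Mat k n) : mEval x (detPoly k n) = x.det := by
  rw [detPoly, mEval_det]
  congr 1
  ext i j
  simp [mEval]

/-- Left translation of polynomial functions: `(leftTr a p) x = p (a * x)`. -/
noncomputable def leftTr (a : Mat k n) : MPoly k n →ₐ[k] MPoly k n :=
  aeval fun ij => ∑ l, C (a ij.1 l) * X (l, ij.2)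

/-- Right translation of polynomial functions: `(rightTr a p) x = p (x * a)`. -/
noncomputable def rightTr (a : Mat k n) : MPoly k n →ₐ[k] MPoly k n :=
  aeval fun ij => ∑ l, C (a l ij.2) * X (ij.1, l)

lemma mEval_leftTr (a x : Mat k n) (p : MPoly k n) :
    mEval x (leftTr a p) = mEval (a * x) p := by
  induction p using MvPolynomial.induction_on with
  | C c => simp [mEval, leftTr]
  | add p q hp hq => rw [map_add, mEval_add, mEval_add, hp, hq]
  | mul_X p i hp =>
    rw [map_mul, mEval_mul, mEval_mul, hp]
    simp [mEval, leftTr, Matrix.mul_apply]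

lemma mEval_rightTr (a x : Mat k n) (p : MPoly k n) :
    mEval x (rightTr a p) = mEval (x * a) p := by
  induction p using MvPolynomial.induction_on with
  | C c => simp [mEval, rightTr]
  | add p q hp hq => rw [map_add, mEval_add, mEval_add, hp, hq]
  | mul_X p i hp =>
    rw [map_mul, mEval_mul, mEval_mul, hp]
    simp [mEval, rightTr, Matrix.mul_apply, mul_comm]

lemma totalDegree_leftTr_le (a : Mat k n) (p : MPoly k n) :
    (leftTr a p).totalDegree ≤ p.totalDegree := by
  rw [leftTr, aeval_def, eval₂_eq]
  refine totalDegree_finsetSum_le fun d hd => ?_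
  refine (totalDegree_mul _ _).trans ?_
  rw [algebraMap_eq, totalDegree_C, zero_add]
  refine (totalDegree_finsetProd _ _).trans (le_trans ?_ (le_totalDegree hd))
  refine Finset.sum_le_sum fun i _ => (totalDegree_pow _ _).trans ?_
  refine (Nat.mul_le_mul_left (m := 1) _ ?_).trans (Nat.mul_one _).le
  refine totalDegree_finsetSum_le fun l _ => (totalDegree_mul _ _).trans ?_
  rw [totalDegree_C, totalDegree_X]

/-- If scalar functions `b i` are linearly independent, they are separated by as many points. -/
lemma exists_points_det_ne_zero {ι X : Type*} [Fintype ι] [DecidableEq ι] (b : ι → X → k)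
    (hb : LinearIndependent k b) :
    ∃ x : ι → X, (Matrix.of fun i j => b i (x j)).det ≠ 0 := by
  have hspan : ⊤ ≤ Submodule.span k (Set.range fun x i => b i x) := by
    by_contra h
    obtain ⟨f, hf, hle⟩ := Submodule.exists_le_ker_of_lt_top _ (lt_top_iff_ne_top.2 fun h' =>
      h h'.ge)
    apply hf
    have hz : ∑ i, f (Pi.single i 1) • b i = 0 := by
      ext x
      have := hle (Submodule.subset_span ⟨x, rfl⟩)
      rw [LinearMap.mem_ker, LinearMap.pi_apply_eq_sum_univ] at this
      have hs : ∀ i, (Pi.single i 1 : ι → k) = fun j => if i = j then 1 else 0 := fun i => by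
        ext j
        simp [Pi.single_apply, eq_comm]
      simpa [hs, mul_comm] using this
    refine LinearMap.pi_ext' fun i => LinearMap.ext_ring ?_
    simpa using Fintype.linearIndependent_iff.1 hb _ hz i
  let B := Module.Basis.ofSpan hspan
  let B' := B.reindex (B.indexEquiv (Pi.basisFun k ι))
  have hB' : ∀ j, ∃ x, (fun i => b i x) = B' j := fun j => by
    have : B' j ∈ Set.range B := by simp [B']
    exact Module.Basis.ofSpan_subset hspan this
  choose x hx using hB'
  refine ⟨x, ?_⟩
  rw [← isUnit_iff_ne_zero, ← Matrix.isUnit_iff_isUnit_det,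
    ← Matrix.linearIndependent_cols_iff_isUnit]
  have hcol : (Matrix.of fun i j => b i (x j)).col = B' := by
    ext j i
    exact congrFun (hx j) i
  rw [hcol]
  exact B'.linearIndependent

/-- Matrix coefficients, with respect to a basis, of a locally polynomial action by
right translation on a finite-dimensional space of functions. -/
lemma exists_isRightRep_of_basis {S : Set (Mat k n)} {X : Type*} (h1 : (1 : Mat k n) ∈ S)
    (hmul : ∀ a ∈ S, ∀ b ∈ S, a * b ∈ S) (act : S → X → X)
    (act_one : ∀ x, act ⟨1, h1⟩ x = x)
    (act_mul : ∀ a b : S, ∀ x, act ⟨a * b, hmul _ a.2 _ b.2⟩ x = act a (act b x))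
    (U : Submodule k (X → k)) {d : ℕ} (b : Module.Basis (Fin d) k U)
    (hU : ∀ a : S, ∀ f ∈ U, (fun x => f (act a x)) ∈ U)
    (hpoly : ∀ f ∈ U, ∀ x, ∃ p : MPoly k n, ∀ a : S, f (act a x) = mEval a.1 p) :
    ∃ P : Matrix (Fin d) (Fin d) (MPoly k n), IsRightRep S P ∧
      ∀ a : S, ∀ i x, (b i).1 (act a x) = ∑ j, repApply P a.1 i j * (b j).1 x := by
  have hb : LinearIndependent k fun i => (b i).1 :=
    b.linearIndependent.map' U.subtype U.ker_subtype
  obtain ⟨x, hx⟩ := exists_points_det_ne_zero _ hb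
  set B : Matrix (Fin d) (Fin d) k := Matrix.of fun i j => (b i).1 (x j) with hB
  choose p hp using fun i l => hpoly (b i).1 (b i).2 (x l)
  let P : Matrix (Fin d) (Fin d) (MPoly k n) := Matrix.of fun i j => ∑ l, p i l * C (B⁻¹ l j)
  have hP : ∀ a : S, ∀ i y, (b i).1 (act a y) = ∑ j, repApply P a.1 i j * (b j).1 y := by
    intro a i y
    let c : Fin d → Fin d → k := fun i => b.repr ⟨_, hU a (b i).1 (b i).2⟩
    have hc : ∀ i y, (b i).1 (act a y) = ∑ j, c i j * (b j).1 y := fun i y => by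
      have := congrArg (fun f : U => f.1 y) (b.sum_repr ⟨_, hU a (b i).1 (b i).2⟩)
      simp only [Submodule.coe_sum, Finset.sum_apply, Submodule.coe_smul, Pi.smul_apply,
        smul_eq_mul] at this
      exact this.symm
    have hcP : repApply P a.1 = Matrix.of c := by
      have h2 : (Matrix.of fun i l => mEval a.1 (p i l)) = Matrix.of c * B := by
        ext i l
        simp [Matrix.mul_apply, hB, ← hp i l a, hc]
      have h3 : repApply P a.1 = (Matrix.of fun i l => mEval a.1 (p i l)) * B⁻¹ := by
        ext i j
        simp [repApply, P, mEval_sum, mEval_mul, mEval_C, Matrix.mul_apply]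
      rw [h3, h2, Matrix.mul_nonsing_inv_cancel_right _ _ (isUnit_iff_ne_zero.2 hx)]
    rw [hcP]
    exact hc i y
  have huniq : ∀ A A' : Matrix (Fin d) (Fin d) k,
      (∀ i y, ∑ j, A i j * (b j).1 y = ∑ j, A' i j * (b j).1 y) → A = A' := by
    intro A A' h
    ext i j
    have := Fintype.linearIndependent_iff.1 hb (fun j => A i j - A' i j) (by
      ext y
      simp [sub_mul, Finset.sum_sub_distrib, h i y]) j
    exact sub_eq_zero.1 this
  refine ⟨P, ⟨huniq _ _ fun i y => ?_, fun a ha a' ha' => huniq _ _ fun i y => ?_⟩, hP⟩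
  · rw [← hP ⟨1, h1⟩, act_one]
    simp [Matrix.one_apply]
  · rw [← hP ⟨_, hmul a ha a' ha'⟩, act_mul ⟨a, ha⟩ ⟨a', ha'⟩, hP ⟨a, ha⟩]
    simp_rw [hP ⟨a', ha'⟩, Matrix.mul_apply, Finset.mul_sum, Finset.sum_mul]
    rw [Finset.sum_comm]
    simp_rw [mul_assoc]

/-- The ideal of polynomials vanishing on a set of matrices. -/
def vanishing (X : Set (Mat k n)) : Ideal (MPoly k n) where
  carrier := {p | VanishesOn X p}
  add_mem' hp hq x hx := by rw [mEval_add, hp x hx, hq x hx, add_zero]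
  zero_mem' _ _ := map_zero _
  smul_mem' c p hp x hx := by rw [smul_eq_mul, mEval_mul, hp x hx, mul_zero]

/-- Restriction of polynomials to a set of matrices, as functions. -/
noncomputable def restrictTo (X : Set (Mat k n)) : MPoly k n →ₗ[k] (X → k) where
  toFun p x := mEval x.1 p
  map_add' p q := funext fun x => mEval_add x.1 p q
  map_smul' c p := funext fun x => mEval_smul x.1 c p

lemma restrictTo_apply {X : Set (Mat k n)} (p : MPoly k n) (x : X) :
    restrictTo X p x = mEval x.1 p :=
  rfl

/-- Polynomials of bounded degree in a translation-stable subspace afford a representation. -/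
lemma exists_stable_family {H M : Set (Mat k n)} (h1 : (1 : Mat k n) ∈ H)
    (hmul : ∀ a ∈ H, ∀ b ∈ H, a * b ∈ H) (hHM : ∀ a ∈ H, ∀ m ∈ M, a * m ∈ M)
    (N : Submodule k (MPoly k n)) (hN : ∀ a ∈ H, ∀ p ∈ N, leftTr a p ∈ N) (D : ℕ) :
    ∃ (d : ℕ) (κ : Fin d → MPoly k n) (P : Matrix (Fin d) (Fin d) (MPoly k n)),
      (∀ i, κ i ∈ N) ∧ LinearIndependent k (fun i => restrictTo M (κ i)) ∧
      (∀ p ∈ N, p.totalDegree ≤ D →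
        ∃ c : Fin d → k, ∀ m ∈ M, mEval m p = ∑ i, c i * mEval m (κ i)) ∧
      IsRightRep H P ∧
      ∀ a ∈ H, ∀ i, ∀ m ∈ M, mEval (a * m) (κ i) = ∑ j, repApply P a i j * mEval m (κ j) := by
  let U : Submodule k (M → k) :=
    (N ⊓ restrictTotalDegree (Fin n × Fin n) k D).map (restrictTo M)
  have hfin : FiniteDimensional k U := inferInstance
  let b := Module.finBasis k U
  have hκ : ∀ i, ∃ p ∈ N, restrictTo M p = (b i).1 := fun i => by
    obtain ⟨p, hp, h⟩ := (b i).2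
    exact ⟨p, hp.1, h⟩
  choose κ hκN hκ using hκ
  obtain ⟨P, hP, hact⟩ := exists_isRightRep_of_basis h1 hmul
    (fun (a : H) (m : M) => (⟨a.1 * m.1, hHM _ a.2 _ m.2⟩ : M)) (fun x => Subtype.ext (one_mul _))
    (fun a b x => Subtype.ext (mul_assoc _ _ _)) U b
    (by
      rintro a _ ⟨p, ⟨hpN, hpD⟩, rfl⟩
      refine ⟨leftTr a.1 p, ⟨hN _ a.2 _ hpN, ?_⟩, ?_⟩
      · exact (mem_restrictTotalDegree _ _ _).2 ((totalDegree_leftTr_le _ _).trans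
          ((mem_restrictTotalDegree _ _ _).1 hpD))
      · ext m
        exact mEval_leftTr _ _ _)
    (by
      rintro _ ⟨p, -, rfl⟩ x
      exact ⟨rightTr x.1 p, fun a => (mEval_rightTr _ _ _).symm⟩)
  refine ⟨_, κ, P, hκN, ?_, fun p hp hpD => ?_, hP, fun a ha i m hm => ?_⟩
  · simp_rw [hκ]
    exact b.linearIndependent.map' U.subtype U.ker_subtype
  · have hpU : restrictTo M p ∈ U := ⟨p, ⟨hp, (mem_restrictTotalDegree _ _ _).2 hpD⟩, rfl⟩
    refine ⟨b.repr ⟨_, hpU⟩, fun m hm => ?_⟩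
    have := congrArg (fun f : U => f.1 ⟨m, hm⟩) (b.sum_repr ⟨_, hpU⟩)
    simp only [Submodule.coe_sum, Finset.sum_apply, Submodule.coe_smul, Pi.smul_apply,
      smul_eq_mul, ← hκ] at this
    exact this.symm
  · have := hact ⟨a, ha⟩ i ⟨m, hm⟩
    simp only [← hκ] at this
    exact this

lemma ZClosed.inter {X Y : Set (Mat k n)} (hX : ZClosed X) (hY : ZClosed Y) :
    ZClosed (X ∩ Y) := by
  obtain ⟨S, rfl⟩ := hX
  obtain ⟨T, rfl⟩ := hY
  refine ⟨S ∪ T, ?_⟩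
  ext x
  simp [or_imp, forall_and]

/-- A polynomial without zeros on a closed set has a polynomial inverse there. -/
lemma ZClosed.exists_mul_eq_one [IsAlgClosed k] {X : Set (Mat k n)} (hX : ZClosed X)
    (β : MPoly k n) (hβ : ∀ x ∈ X, mEval x β ≠ 0) :
    ∃ δ : MPoly k n, ∀ x ∈ X, mEval x δ * mEval x β = 1 := by
  obtain ⟨S, rfl⟩ := hX
  have htop : Ideal.span {β} ⊔ Ideal.span S = ⊤ := by
    by_contra hne
    obtain ⟨m, hm, hle⟩ := Ideal.exists_le_maximal _ hne
    obtain ⟨x, rfl⟩ := isMaximal_iff_eq_vanishingIdeal_singleton.1 hm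
    refine hβ (Matrix.of fun i j => x (i, j)) (fun p hp => ?_) ?_
    · exact (mem_vanishingIdeal_singleton_iff x p).1
        (hle (Ideal.mem_sup_right (Ideal.subset_span hp)))
    · exact (mem_vanishingIdeal_singleton_iff x β).1
        (hle (Ideal.mem_sup_left (Ideal.mem_span_singleton_self β)))
  obtain ⟨δ, q, hq, h⟩ := Ideal.mem_span_singleton_sup.1 ((Ideal.eq_top_iff_one _).1 htop)
  refine ⟨δ, fun x hx => ?_⟩
  have hle : Ideal.span S ≤ vanishing {x | ∀ p ∈ S, mEval x p = 0} :=
    Ideal.span_le.2 fun p hp y hy => hy p hp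
  rw [← mEval_one x, ← h, mEval_add, mEval_mul, hle hq x hx, add_zero]

lemma IsAlgMonoid.inv_mem [Infinite k] {M : Set (Mat k n)} (hM : IsAlgMonoid M) {x : Mat k n}
    (hx : x ∈ M) (hdet : x.det ≠ 0) : x⁻¹ ∈ M := by
  have hu : IsUnit x.det := isUnit_iff_ne_zero.2 hdet
  have hvan : ∀ p, VanishesOn M p → mEval x⁻¹ p = 0 := by
    intro p hp
    let N := (vanishing M).restrictScalars k ⊓
      restrictTotalDegree (Fin n × Fin n) k p.totalDegree
    have hN : ∀ q ∈ N, (leftTr x).toLinearMap q ∈ N := fun q hq =>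
      ⟨fun m hm => (mEval_leftTr _ _ _).trans (hq.1 _ (hM.mul_mem _ hx _ hm)),
        (mem_restrictTotalDegree _ _ _).2 ((totalDegree_leftTr_le _ _).trans
          ((mem_restrictTotalDegree _ _ _).1 hq.2))⟩
    have hinj : Function.Injective ((leftTr x).toLinearMap.restrict hN) := by
      intro q q' h
      refine Subtype.ext (MvPolynomial.funext fun y => ?_)
      let z : Mat k n := Matrix.of fun i j => y (i, j)
      have h' : mEval (x⁻¹ * z) (leftTr x q.1) = mEval (x⁻¹ * z) (leftTr x q'.1) :=
        congrArg (fun r : N => mEval (x⁻¹ * z) r.1) h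
      rwa [mEval_leftTr, mEval_leftTr, Matrix.mul_nonsing_inv_cancel_left _ _ hu] at h'
    have : FiniteDimensional k N := inferInstance
    obtain ⟨q, hq⟩ := LinearMap.injective_iff_surjective.1 hinj
      ⟨p, hp, (mem_restrictTotalDegree _ _ _).2 le_rfl⟩
    have hq' : leftTr x q.1 = p := congrArg Subtype.val hq
    rw [← hq', mEval_leftTr, Matrix.mul_nonsing_inv _ hu]
    exact q.2.1 _ hM.one_mem
  obtain ⟨S, hS⟩ := hM.zclosed
  have : x⁻¹ ∈ {x | ∀ p ∈ S, mEval x p = 0} := fun p hp => hvan p fun y hy => by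
    rw [hS] at hy
    exact hy p hp
  rwa [hS]

lemma IsRightRep.exists_dual [IsAlgClosed k] {H G : Set (Mat k n)} (hH : IsSubgroupOf H G)
    (hHcl : ZClosed H) {d : ℕ} {B : Matrix (Fin d) (Fin d) (MPoly k n)} (hB : IsRightRep H B) :
    ∃ Q : Matrix (Fin d) (Fin d) (MPoly k n), IsRightRep H Q ∧
      ∀ h ∈ H, (repApply B h).transpose * repApply Q h = 1 := by
  obtain ⟨-, h1, hmul, hinv⟩ := hH
  have hdet : ∀ h ∈ H, mEval h B.det ≠ 0 := by
    intro h hh h0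
    obtain ⟨h', hh', hhh', -⟩ := hinv h hh
    have := congrArg Matrix.det (hB.2 h hh h' hh')
    rw [hhh', hB.1, Matrix.det_mul, Matrix.det_one] at this
    rw [mEval_det] at h0
    change (repApply B h).det = 0 at h0
    simp [h0] at this
  obtain ⟨δ, hδ⟩ := hHcl.exists_mul_eq_one _ hdet
  let Q : Matrix (Fin d) (Fin d) (MPoly k n) := (δ • B.adjugate).transpose
  have hmulQ : ∀ h ∈ H, (repApply B h).transpose * repApply Q h = 1 := by
    intro h hh
    have hQ : repApply Q h = (mEval h δ • (repApply B h).adjugate).transpose := by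
      have : (repApply B h).adjugate = Matrix.of fun i j => mEval h (B.adjugate i j) :=
        (RingHom.map_adjugate (eval fun ij : Fin n × Fin n => h ij.1 ij.2) B).symm
      rw [this]
      ext i j
      simp [repApply, Q, mEval_mul]
    rw [hQ, ← Matrix.transpose_mul, Matrix.smul_mul, Matrix.adjugate_mul, smul_smul]
    have := hδ h hh
    rw [mEval_det] at this
    change mEval h δ * (repApply B h).det = 1 at this
    rw [this, one_smul, Matrix.transpose_one]
  refine ⟨Q, ⟨?_, fun a ha b hb => ?_⟩, hmulQ⟩
  · simpa [hB.1] using hmulQ 1 h1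
  · have hleft := mul_eq_one_comm.1 (hmulQ _ (hmul a ha b hb))
    refine left_inv_eq_right_inv hleft ?_
    rw [hB.2 a ha b hb, Matrix.transpose_mul, Matrix.mul_assoc,
      ← Matrix.mul_assoc _ (repApply Q a), hmulQ a ha, Matrix.one_mul, hmulQ b hb]

lemma IrreducibleSet.not_vanishesOn_mul {M : Set (Mat k n)} (hM : IrreducibleSet M)
    {p q : MPoly k n} (hp : ¬ VanishesOn M p) (hq : ¬ VanishesOn M q) :
    ¬ VanishesOn M (p * q) :=
  fun h => (hM.2 p q h).elim hp hq

lemma not_vanishesOn_of_ne_zero {M : Set (Mat k n)} {p : MPoly k n} {m : Mat k n} (hm : m ∈ M)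
    (hp : mEval m p ≠ 0) : ¬ VanishesOn M p :=
  fun h => hp (h m hm)

lemma leftObservable_of_modules_embed [IsAlgClosed k] {M H : Set (Mat k n)} (hM : IsAlgMonoid M)
    (hMirr : IrreducibleSet M) (hH : IsSubgroupOf H (unitGroup M)) (hHcl : ZClosed H)
    (hemb : ∀ (e : ℕ) (Q : Matrix (Fin e) (Fin e) (MPoly k n)), IsRightRep H Q →
        ∃ (d : ℕ) (P : Matrix (Fin d) (Fin d) (MPoly k n)) (ξ : (Fin e → k) →ₗ[k] (Fin d → k)),
          IsRightRep M P ∧ Function.Injective ξ ∧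
          ∀ h ∈ H, ∀ v : Fin e → k,
            ξ (Matrix.vecMul v (repApply Q h)) = Matrix.vecMul (ξ v) (repApply P h)) :
    LeftObservable H M := by
  rintro J hJv hJs ⟨p₀, hp₀J, hp₀⟩
  have : Infinite k := IsAlgClosed.instInfinite
  have hHM : ∀ h ∈ H, h ∈ M := fun h hh => (hH.1 hh).1
  have hJ : ∀ h ∈ H, ∀ p ∈ J.restrictScalars k, leftTr h p ∈ J.restrictScalars k := by
    intro h hh p hp
    obtain ⟨p', hp', heq⟩ := hJs p hp h hh
    have hmem := J.add_mem (hJv (leftTr h p - p') fun m hm => by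
      rw [mEval_sub, mEval_leftTr, heq m hm, sub_self]) hp'
    rwa [sub_add_cancel] at hmem
  obtain ⟨e, κ, B, hκJ, -, hspan, hB, hact⟩ := exists_stable_family hH.2.1 hH.2.2.1
    (fun a ha m hm => hM.mul_mem a (hHM a ha) m hm) (J.restrictScalars k) hJ p₀.totalDegree
  obtain ⟨Q, hQ, hBQ⟩ := hB.exists_dual hH hHcl
  obtain ⟨d, P, ξ, hP, hξ, hequiv⟩ := hemb e Q hQ
  obtain ⟨x, hxM, hx⟩ : ∃ x ∈ M, mEval x (p₀ * detPoly k n) ≠ 0 := by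
    have := hMirr.not_vanishesOn_mul hp₀ (not_vanishesOn_of_ne_zero (p := detPoly k n) hM.one_mem
      (by rw [mEval_detPoly, Matrix.det_one]; exact one_ne_zero))
    simpa [VanishesOn] using this
  rw [mEval_mul, mEval_detPoly] at hx
  have hxdet := right_ne_zero_of_mul hx
  have hxinv := hM.inv_mem hxM hxdet
  let b : Mat k n → Fin e → k := fun m i => mEval m (κ i)
  have hbx : b x ≠ 0 := by
    intro h0
    obtain ⟨c, hc⟩ := hspan p₀ hp₀J le_rfl
    refine left_ne_zero_of_mul hx ?_
    rw [hc x hxM]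
    exact Finset.sum_eq_zero fun i _ => mul_eq_zero_of_right _ (congrFun h0 i)
  let q : Fin d → MPoly k n := fun j =>
    ∑ l, (∑ i, C (ξ (Pi.single i 1) l) * κ i) * rightTr x⁻¹ (P l j)
  have hq : ∀ m j, mEval m (q j) = Matrix.vecMul (ξ (b m)) (repApply P (m * x⁻¹)) j := by
    intro m j
    simp only [q, mEval_sum, mEval_mul, mEval_rightTr, mEval_C, Matrix.vecMul, dotProduct,
      repApply, Matrix.of_apply]
    refine Finset.sum_congr rfl fun l _ => ?_
    congr 1
    conv_rhs => rw [pi_eq_sum_univ' (b m)]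
    simp only [map_sum, map_smul, Finset.sum_apply, Pi.smul_apply, smul_eq_mul, b]
    refine Finset.sum_congr rfl fun i _ => ?_
    rw [mul_comm]
  obtain ⟨j, hj⟩ : ∃ j, ξ (b x) j ≠ 0 :=
    Function.ne_iff.1 ((map_ne_zero_iff ξ hξ).2 hbx)
  refine ⟨q j, J.sum_mem fun l _ => J.mul_mem_right _ (J.sum_mem fun i _ =>
    J.mul_mem_left _ (hκJ i)), not_vanishesOn_of_ne_zero hxM ?_, fun h hh m hm => ?_⟩
  · rwa [hq, Matrix.mul_nonsing_inv _ (isUnit_iff_ne_zero.2 hxdet), hP.1, Matrix.vecMul_one]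
  · have hb : b (h * m) = Matrix.vecMul (b m) (repApply B h).transpose := by
      ext i
      rw [Matrix.vecMul_transpose]
      exact hact h hh i m hm
    rw [hq, hq, Matrix.mul_assoc, hP.2 h (hHM h hh) _ (hM.mul_mem _ hm _ hxinv),
      ← Matrix.vecMul_vecMul, ← hequiv h hh, hb, Matrix.vecMul_vecMul, hBQ h hh,
      Matrix.vecMul_one]

lemma det_of_sumElim_sum {ι m : Type*} [Fintype m] [DecidableEq m] (s : Finset ι)
    (R : m → m ⊕ Unit → k) (c : ι → k) (w : ι → m ⊕ Unit → k) :
    (Matrix.of (Sum.elim R fun _ => ∑ i ∈ s, c i • w i)).det =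
      ∑ i ∈ s, c i * (Matrix.of (Sum.elim R fun _ => w i)).det := by
  have hupd : ∀ y : m ⊕ Unit → k, Matrix.of (Sum.elim R fun _ => y) =
      Function.update (Sum.elim R fun _ => 0) (Sum.inr ()) y := by
    intro y
    ext a b
    rcases a with a | a <;> simp [Function.update]
  simp_rw [hupd]
  change Matrix.detRowAlternating _ = ∑ i ∈ s, c i * Matrix.detRowAlternating _
  rw [AlternatingMap.map_update_sum]
  refine Finset.sum_congr rfl fun i _ => ?_
  rw [AlternatingMap.map_update_smul, smul_eq_mul]

lemma det_of_sumElim_eq_mul {m : Type*} [Fintype m] [DecidableEq m] (A : Matrix m m k)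
    {R R' : m → m ⊕ Unit → k} {y y' : m ⊕ Unit → k} (c : m → k)
    (hR : ∀ s t, R' s t = ∑ i, A s i * R i t) (hy : ∀ t, y' t = ∑ i, c i * R i t + y t) :
    (Matrix.of (Sum.elim R' fun _ => y')).det =
      A.det * (Matrix.of (Sum.elim R fun _ => y)).det := by
  have hprod : Matrix.of (Sum.elim R' fun _ => y') =
      Matrix.fromBlocks A 0 (Matrix.of fun _ => c) (1 : Matrix Unit Unit k) *
        Matrix.of (Sum.elim R fun _ => y) := by
    ext (s | s) t
    · simp [Matrix.mul_apply, hR]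
    · simp [Matrix.mul_apply, hy]
  rw [hprod, Matrix.det_mul, Matrix.det_fromBlocks_zero₁₂, Matrix.det_one, mul_one]

/-- For a semi-invariant `f` on `M`, observability yields a semi-invariant of opposite weight. -/
lemma LeftObservable.exists_inverse_weight {M H : Set (Mat k n)} (hobs : LeftObservable H M)
    (hMirr : IrreducibleSet M) (hHM : ∀ h ∈ H, ∀ m ∈ M, h * m ∈ M) {f : MPoly k n}
    (hf : ¬ VanishesOn M f) (χ : Mat k n → k)
    (hχ : ∀ h ∈ H, ∀ m ∈ M, mEval (h * m) f = χ h * mEval m f) :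
    ∃ g : MPoly k n, ¬ VanishesOn M g ∧
      ∀ h ∈ H, ∀ m ∈ M, χ h * mEval (h * m) g = mEval m g := by
  have hmem : ∀ p, p ∈ Ideal.span {f} ⊔ vanishing M ↔
      ∃ g, ∀ m ∈ M, mEval m p = mEval m g * mEval m f := by
    intro p
    rw [Ideal.mem_span_singleton_sup]
    constructor
    · rintro ⟨g, q, hq, rfl⟩
      exact ⟨g, fun m hm => by rw [mEval_add, mEval_mul, hq m hm, add_zero]⟩
    · rintro ⟨g, hg⟩
      exact ⟨g, p - g * f, fun m hm => by rw [mEval_sub, mEval_mul, hg m hm, sub_self],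
        add_sub_cancel _ _⟩
  obtain ⟨p, hp, hpM, hinv⟩ := hobs (Ideal.span {f} ⊔ vanishing M)
    (fun p hp => Ideal.mem_sup_right hp)
    (by
      intro p hp h hh
      obtain ⟨g, hg⟩ := (hmem p).1 hp
      refine ⟨leftTr h p, (hmem _).2 ⟨C (χ h) * leftTr h g, fun m hm => ?_⟩,
        fun m _ => mEval_leftTr _ _ _⟩
      rw [mEval_leftTr, hg _ (hHM h hh m hm), hχ h hh m hm, mEval_mul, mEval_C, mEval_leftTr]
      ring)
    ⟨f, Ideal.mem_sup_left (Ideal.mem_span_singleton_self f), hf⟩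
  obtain ⟨g, hg⟩ := (hmem p).1 hp
  refine ⟨g, fun hgv => hpM fun m hm => by rw [hg m hm, hgv m hm, zero_mul],
    fun h hh m hm => ?_⟩
  have hprod : VanishesOn M ((C (χ h) * leftTr h g - g) * f) := by
    intro m hm
    have := hinv h hh m hm
    rw [hg _ (hHM h hh m hm), hg m hm, hχ h hh m hm] at this
    rw [mEval_mul, mEval_sub, mEval_mul, mEval_C, mEval_leftTr]
    linear_combination this
  have := ((hMirr.2 _ _ hprod).resolve_right hf) m hm
  rwa [mEval_sub, mEval_mul, mEval_C, mEval_leftTr, sub_eq_zero] at this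

lemma linearIndependent_sumElim_restrictTo {M : Set (Mat k n)} (h1 : (1 : Mat k n) ∈ M) {r : ℕ}
    {κ : Fin r → MPoly k n} (hκ : ∀ i, mEval 1 (κ i) = 0)
    (hind : LinearIndependent k fun i => restrictTo M (κ i)) {u : MPoly k n}
    (hu : mEval 1 u ≠ 0) :
    LinearIndependent k
      (Sum.elim (fun i => restrictTo M (κ i)) fun _ : Unit => restrictTo M u) := by
  rw [Fintype.linearIndependent_iff]
  intro c hc
  rw [Fintype.sum_sum_type] at hc
  simp only [Sum.elim_inl, Sum.elim_inr, Finset.univ_unique, Finset.sum_singleton] at hc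
  have hc0 : c (Sum.inr ()) = 0 := by
    have h := congrFun hc ⟨1, h1⟩
    simp only [Pi.add_apply, Finset.sum_apply, Pi.smul_apply, restrictTo_apply, hκ, smul_eq_mul,
      mul_zero, Finset.sum_const_zero, zero_add, Pi.zero_apply] at h
    exact (mul_eq_zero.1 h).resolve_right hu
  have hc' := Fintype.linearIndependent_iff.1 hind (fun i => c (Sum.inl i)) (by
    simpa [hc0] using hc)
  rintro (i | i)
  · exact hc' i
  · exact hc0

/-- If `q` is equivariant modulo the span of a stable family `κ`, then bordered determinants
make it equivariant up to the determinant of the action on `κ`. -/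
lemma exists_bordered_covariant {M H : Set (Mat k n)} (hM : IsAlgMonoid M)
    {r e : ℕ} (κ : Fin r → MPoly k n)
    (hκ : ∀ i, mEval 1 (κ i) = 0) (hind : LinearIndependent k fun i => restrictTo M (κ i))
    (A : Mat k n → Matrix (Fin r) (Fin r) k) (B : Mat k n → Matrix (Fin e) (Fin e) k)
    (hact : ∀ h ∈ H, ∀ i, ∀ m ∈ M, mEval (h * m) (κ i) = ∑ j, A h i j * mEval m (κ j))
    (q : Fin e → MPoly k n)
    (hq : ∀ h ∈ H, ∀ i, ∃ c : Fin r → k, ∀ m ∈ M, mEval (h * m) (q i) =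
      ∑ s, c s * mEval m (κ s) + ∑ l, B h i l * mEval m (q l))
    (v : Fin e → k) (hv : ∑ i, v i * mEval 1 (q i) ≠ 0) :
    ∃ E : Fin e → MPoly k n,
      (∀ h ∈ H, ∀ m ∈ M, ∀ i,
        mEval (h * m) (E i) = (A h).det * ∑ l, B h i l * mEval m (E l)) ∧
      ¬ VanishesOn M (∑ i, C (v i) * E i) := by
  obtain ⟨a, ha⟩ := exists_points_det_ne_zero _ (linearIndependent_sumElim_restrictTo
    (u := ∑ i, C (v i) * q i) hM.one_mem hκ hind (by
      simpa only [mEval_sum, mEval_mul, mEval_C] using hv))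
  let R : Mat k n → Fin r → Fin r ⊕ Unit → k := fun m i t => mEval (m * (a t).1) (κ i)
  let w : Fin e → Mat k n → Fin r ⊕ Unit → k := fun i m t => mEval (m * (a t).1) (q i)
  let E : Fin e → MPoly k n := fun i =>
    (Matrix.of fun s t => rightTr (a t).1 (Sum.elim κ (fun _ => q i) s)).det
  have hE : ∀ i m, mEval m (E i) = (Matrix.of (Sum.elim (R m) fun _ => w i m)).det := by
    intro i m
    rw [mEval_det]
    congr 1
    ext (s | s) t <;> simp [R, w, mEval_rightTr]
  refine ⟨E, fun h hh m hm i => ?_, not_vanishesOn_of_ne_zero hM.one_mem ?_⟩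
  · obtain ⟨c, hc⟩ := hq h hh i
    simp_rw [hE]
    rw [← det_of_sumElim_sum]
    refine det_of_sumElim_eq_mul _ c (fun s t => ?_) fun t => ?_
    · simp only [R, Matrix.mul_assoc]
      exact hact h hh s _ (hM.mul_mem _ hm _ (a t).2)
    · simp only [R, w, Matrix.mul_assoc, Finset.sum_apply, Pi.smul_apply, smul_eq_mul]
      exact hc _ (hM.mul_mem _ hm _ (a t).2)
  · simp only [mEval_sum, mEval_mul, mEval_C, hE]
    rw [← det_of_sumElim_sum]
    convert ha using 2
    ext (s | s) t
    · simp [R, restrictTo_apply]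
    · simp [w, restrictTo_apply, mEval_mul, mEval_C]

/-- Given an observable subgroup, equivariant polynomial maps to an `H`-module separate vectors. -/
lemma LeftObservable.exists_covariant {M H : Set (Mat k n)} (hobs : LeftObservable H M)
    (hM : IsAlgMonoid M) (hMirr : IrreducibleSet M) (hH : IsSubgroupOf H (unitGroup M))
    {e : ℕ} {Q : Matrix (Fin e) (Fin e) (MPoly k n)} (hQ : IsRightRep H Q)
    {v : Fin e → k} (hv : v ≠ 0) :
    ∃ φ : Fin e → MPoly k n,
      (∀ h ∈ H, ∀ m ∈ M, ∀ i,
        mEval (h * m) (φ i) = ∑ l, repApply Q h i l * mEval m (φ l)) ∧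
      ∃ m ∈ M, ∑ i, v i * mEval m (φ i) ≠ 0 := by
  obtain ⟨j, hj⟩ := Function.ne_iff.1 hv
  have hHM : ∀ h ∈ H, ∀ m ∈ M, h * m ∈ M := fun h hh m hm => hM.mul_mem _ (hH.1 hh).1 _ hm
  obtain ⟨D, hD⟩ : ∃ D, ∀ i, (Q i j).totalDegree ≤ D := ⟨_, fun i =>
    Finset.le_sup (f := fun i => (Q i j).totalDegree) (Finset.mem_univ i)⟩
  obtain ⟨r, κ, A, hκ, hind, hspan, -, hact⟩ := exists_stable_family hH.2.1 hH.2.2.1 hHM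
    ((vanishing H).restrictScalars k) (fun a ha p hp x hx => by
      rw [mEval_leftTr]
      exact hp _ (hH.2.2.1 a ha x hx)) D
  obtain ⟨a', ha'⟩ := exists_points_det_ne_zero _ hind
  obtain ⟨f, hf⟩ : ∃ f : MPoly k n, ∀ m,
      mEval m f = (Matrix.of fun i t => mEval (m * (a' t).1) (κ i)).det :=
    ⟨(Matrix.of fun i t => rightTr (a' t).1 (κ i)).det, fun m => by
      simp [mEval_det, mEval_rightTr]⟩
  have hf0 : ¬ VanishesOn M f := not_vanishesOn_of_ne_zero hM.one_mem (by
    rw [hf]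
    simpa [restrictTo_apply] using ha')
  obtain ⟨g, hg0, hg⟩ := hobs.exists_inverse_weight hMirr hHM hf0
    (fun h => (repApply A h).det) (fun h hh m hm => by
      rw [hf, hf, ← Matrix.det_mul]
      congr 1
      ext i t
      rw [Matrix.mul_apply, Matrix.of_apply, Matrix.mul_assoc]
      exact hact h hh i _ (hM.mul_mem _ hm _ (a' t).2))
  have hQ1 : ∀ i, mEval 1 (Q i j) = (1 : Matrix (Fin e) (Fin e) k) i j := fun i =>
    congrFun (congrFun hQ.1 i) j
  obtain ⟨E, hEact, hEv⟩ := exists_bordered_covariant hM κ (fun i => hκ i 1 hH.2.1) hind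
    (repApply A) (repApply Q) hact (fun i => Q i j)
    (fun h hh i => by
      obtain ⟨c, hc⟩ := hspan (leftTr h (Q i j) - ∑ l, C (repApply Q h i l) * Q l j)
        (fun x hx => by
          have := congrFun (congrFun (hQ.2 h hh x hx) i) j
          rw [Matrix.mul_apply] at this
          simp only [mEval_sub, mEval_leftTr, mEval_sum, mEval_mul, mEval_C]
          exact sub_eq_zero.2 this)
        ((totalDegree_sub _ _).trans (max_le ((totalDegree_leftTr_le _ _).trans (hD i))
          (totalDegree_finsetSum_le fun l _ => (totalDegree_mul _ _).trans (by
            rw [totalDegree_C, zero_add]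
            exact hD l))))
      refine ⟨c, fun m hm => sub_eq_iff_eq_add.1 ?_⟩
      rw [← hc m hm]
      simp only [mEval_sub, mEval_leftTr, mEval_sum, mEval_mul, mEval_C])
    v (by simpa [hQ1, Matrix.one_apply] using hj)
  refine ⟨fun i => g * E i, fun h hh m hm i => ?_, ?_⟩
  · simp only [mEval_mul]
    rw [hEact h hh m hm, ← hg h hh m hm, Finset.mul_sum, Finset.mul_sum]
    exact Finset.sum_congr rfl fun l _ => by ring
  · have := hMirr.not_vanishesOn_mul hg0 hEv
    simp only [VanishesOn, not_forall] at this
    obtain ⟨m, hm, h⟩ := this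
    refine ⟨m, hm, ?_⟩
    simpa [mEval_mul, mEval_sum, mEval_C, Finset.mul_sum, mul_left_comm] using h

/-- An `H`-module separated by equivariant polynomial maps embeds into an `M`-module. -/
lemma exists_module_embedding {M H : Set (Mat k n)} (hM : IsAlgMonoid M)
    (hHM : ∀ h ∈ H, h ∈ M) {e : ℕ} {Q : Matrix (Fin e) (Fin e) (MPoly k n)}
    (hsep : ∀ v : Fin e → k, v ≠ 0 → ∃ φ : Fin e → MPoly k n,
      (∀ h ∈ H, ∀ m ∈ M, ∀ i,
        mEval (h * m) (φ i) = ∑ l, repApply Q h i l * mEval m (φ l)) ∧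
      ∃ m ∈ M, ∑ i, v i * mEval m (φ i) ≠ 0) :
    ∃ (d : ℕ) (P : Matrix (Fin d) (Fin d) (MPoly k n)) (ξ : (Fin e → k) →ₗ[k] (Fin d → k)),
      IsRightRep M P ∧ Function.Injective ξ ∧
      ∀ h ∈ H, ∀ v : Fin e → k,
        ξ (Matrix.vecMul v (repApply Q h)) = Matrix.vecMul (ξ v) (repApply P h) := by
  let Cov := {φ : Fin e → MPoly k n // ∀ h ∈ H, ∀ m ∈ M, ∀ i,
        mEval (h * m) (φ i) = ∑ l, repApply Q h i l * mEval m (φ l)}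
  obtain ⟨y, hy⟩ := exists_points_det_ne_zero
    (fun i (y : Cov × M) => mEval y.2.1 (y.1.1 i)) (by
      rw [Fintype.linearIndependent_iff]
      intro v hv
      by_contra hne
      obtain ⟨φ, hφ, m, hm, h⟩ := hsep v fun h0 => hne (congrFun h0)
      refine h ?_
      simpa using congrFun hv (⟨φ, hφ⟩, ⟨m, hm⟩))
  let φ : Fin e → Fin e → MPoly k n := fun t => (y t).1.1
  have hφ : ∀ t, ∀ h ∈ H, ∀ m ∈ M, ∀ i,
      mEval (h * m) (φ t i) = ∑ l, repApply Q h i l * mEval m (φ t l) := fun t => (y t).1.2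
  let D := Finset.univ.sup fun ti : Fin e × Fin e => (φ ti.1 ti.2).totalDegree
  have hD : ∀ t i, (φ t i).totalDegree ≤ D := fun t i =>
    Finset.le_sup (f := fun ti : Fin e × Fin e => (φ ti.1 ti.2).totalDegree)
      (Finset.mem_univ (t, i))
  let L : (Fin e → restrictTotalDegree (Fin n × Fin n) k D) →ₗ[k] (Fin e × M → k) :=
    { toFun := fun p tm => restrictTo M (p tm.1).1 tm.2
      map_add' := fun p q => by ext; simp
      map_smul' := fun c p => by ext; simp }
  let U := LinearMap.range L
  let b := Module.finBasis k U
  obtain ⟨P, hP, hact⟩ := exists_isRightRep_of_basis hM.one_mem hM.mul_mem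
    (fun (a : M) (tm : Fin e × M) => (tm.1, (⟨a.1 * tm.2.1, hM.mul_mem _ a.2 _ tm.2.2⟩ : M)))
    (fun x => Prod.ext rfl (Subtype.ext (one_mul _)))
    (fun a b x => Prod.ext rfl (Subtype.ext (mul_assoc _ _ _))) U b
    (by
      rintro a _ ⟨p, rfl⟩
      refine ⟨fun t => ⟨leftTr a.1 (p t).1, ?_⟩, ?_⟩
      · exact (mem_restrictTotalDegree _ _ _).2 ((totalDegree_leftTr_le _ _).trans
          ((mem_restrictTotalDegree _ _ _).1 (p t).2))
      · ext tm
        exact mEval_leftTr _ _ _)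
    (by
      rintro _ ⟨p, rfl⟩ x
      exact ⟨rightTr x.2.1 (p x.1).1, fun a => (mEval_rightTr _ _ _).symm⟩)
  let T : (Fin e → k) →ₗ[k] U := L.rangeRestrict ∘ₗ
    LinearMap.pi fun t => Fintype.linearCombination k fun i =>
      (⟨φ t i, (mem_restrictTotalDegree _ _ _).2 (hD t i)⟩ :
        restrictTotalDegree (Fin n × Fin n) k D)
  have hT : ∀ v t (m : M), (T v).1 (t, m) = ∑ i, v i * mEval m.1 (φ t i) := by
    intro v t m
    change mEval m.1 (Fintype.linearCombination k _ v : restrictTotalDegree _ k D).1 = _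
    simp [Fintype.linearCombination_apply, mEval_sum, mEval_smul]
  let ξ : (Fin e → k) →ₗ[k] (Fin _ → k) := b.equivFun.toLinearMap ∘ₗ T
  have hξ : ∀ v x, (T v).1 x = ∑ i, ξ v i * (b i).1 x := by
    intro v x
    have := congrArg (fun f : U => f.1 x) (b.sum_equivFun (T v))
    simp only [Submodule.coe_sum, Finset.sum_apply, Submodule.coe_smul, Pi.smul_apply,
      smul_eq_mul] at this
    exact this.symm
  refine ⟨_, P, ξ, hP, ?_, fun h hh v => ?_⟩
  · rw [← LinearMap.ker_eq_bot, LinearMap.ker_eq_bot']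
    intro v hv
    refine Matrix.eq_zero_of_vecMul_eq_zero hy ?_
    ext t
    have h1 := hT v t (y t).2
    rw [hξ, hv] at h1
    simpa [Matrix.vecMul, dotProduct, φ] using h1.symm
  · have hTv : ∀ x, (T (Matrix.vecMul v (repApply Q h))).1 x =
        ∑ j, Matrix.vecMul (ξ v) (repApply P h) j * (b j).1 x := by
      rintro ⟨t, m⟩
      have h1 := hξ v (t, ⟨h * m.1, hM.mul_mem _ (hHM h hh) _ m.2⟩)
      have h2 := fun i => hact ⟨h, hHM h hh⟩ i (t, m)
      simp only at h2
      simp_rw [h2] at h1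
      rw [hT] at h1 ⊢
      simp only [hφ t h hh m.1 m.2] at h1
      simp only [Matrix.vecMul, dotProduct, Finset.sum_mul]
      rw [Finset.sum_comm]
      simp only [Finset.mul_sum, ← mul_assoc] at h1
      rw [h1, Finset.sum_comm]
    have hb : T (Matrix.vecMul v (repApply Q h)) =
        ∑ j, Matrix.vecMul (ξ v) (repApply P h) j • b j := by
      ext x
      simp [hTv]
    change b.equivFun (T _) = _
    rw [hb]
    exact b.equivFun_symm_apply (Matrix.vecMul (ξ v) (repApply P h)) ▸
      b.equivFun.apply_symm_apply _

end

/-- Let `M` be an irreducible affine algebraic monoid with unit group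
`G` and let `H ⊆ G` be a subgroup, closed in `M`.  Then `H` is observable in `M` iff
every finite dimensional rational right `H`-module `V` admits an injective morphism of
right `H`-modules `ξ : V → W|_H` into (the restriction to `H` of) some finite
dimensional rational right `M`-module `W`. -/
theorem observable_in_monoid_iff_modules_embed
    {k : Type} [Field k] [IsAlgClosed k] {n : ℕ}
    (M H : Set (Mat k n)) (hM : IsAlgMonoid M) (hMirr : IrreducibleSet M)
    (hH : IsSubgroupOf H (unitGroup M)) (hHcl : IsClosedIn H M) :
    LeftObservable H M ↔
      ∀ (e : ℕ) (Q : Matrix (Fin e) (Fin e) (MPoly k n)), IsRightRep H Q →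
        ∃ (d : ℕ) (P : Matrix (Fin d) (Fin d) (MPoly k n)) (ξ : (Fin e → k) →ₗ[k] (Fin d → k)),
          IsRightRep M P ∧ Function.Injective ξ ∧
          ∀ h ∈ H, ∀ v : Fin e → k,
            ξ (Matrix.vecMul v (repApply Q h)) = Matrix.vecMul (ξ v) (repApply P h) := by
  constructor
  · intro hobs e Q hQ
    exact exists_module_embedding hM (fun h hh => (hH.1 hh).1)
      fun v hv => hobs.exists_covariant hM hMirr hH hQ hv
  · have hHz : ZClosed H := by
      obtain ⟨-, C, hC, rfl⟩ := hHcl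
      exact hC.inter hM.zclosed
    exact leftObservable_of_modules_embed hM hMirr hH hHz

end AlgebraicMonoid
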